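/- Let q = p^{em} with p an odd prime, m even, t ∣ (p^e - 1), r ≤ m - 1, and n = t p^{er}. Then for any 1 ≤ k ≤ ⌊(p^e + n - 1)/(p^e + 1)⌋ and 0 ≤ l ≤ k - 1, there exists an [n+1, k] MDS code C over F_q whose e-Galois hull Hull_e(C) = C ∩ C^{⊥_e} has dimension exactly l. -/

import Mathlib

/-- The `e`-Galois dual relative to the inner product `⟨x, y⟩ = ∑ i, x i * (y i)^pe`. -/
def galoisDual {F : Type*} [Field F] {ι : Type*} [Fintype ι] (pe : ℕ)
    (C : Submodule F (ι → F)) : Submodule F (ι → F) where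
  carrier := {x | ∀ y ∈ C, ∑ i, x i * (y i) ^ pe = 0}
  add_mem' := by
    intro x y hx hy z hz
    simp only [Pi.add_apply, add_mul, Finset.sum_add_distrib]
    rw [hx z hz, hy z hz, add_zero]
  zero_mem' := by
    intro y _
    simp
  smul_mem' := by
    intro c x hx y hy
    simp only [Pi.smul_apply, smul_eq_mul, mul_assoc, ← Finset.mul_sum]
    rw [hx y hy, mul_zero]

open Polynomial in
/-- The evaluation map of the extended generalized Reed-Solomon code. -/
noncomputable def egrs {F : Type*} [Field F] {n : ℕ} (k : ℕ) (a w : Fin n → F) :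
    degreeLT F k →ₗ[F] (Fin (n + 1) → F) where
  toFun f := Fin.cons ((f : F[X]).coeff (k - 1)) (fun i => w i * (f : F[X]).eval (a i))
  map_add' f g := by
    ext i
    refine Fin.cases ?_ (fun i => ?_) i <;> simp [mul_add]
  map_smul' c f := by
    ext i
    refine Fin.cases ?_ (fun i => ?_) i <;> simp [mul_left_comm]

open Polynomial in
theorem egrs_zero {F : Type*} [Field F] {n : ℕ} (k : ℕ) (a w : Fin n → F) (f : degreeLT F k) :
    egrs k a w f 0 = (f : F[X]).coeff (k - 1) := rfl

open Polynomial in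
theorem egrs_succ {F : Type*} [Field F] {n : ℕ} (k : ℕ) (a w : Fin n → F) (f : degreeLT F k)
    (i : Fin n) : egrs k a w f i.succ = w i * (f : F[X]).eval (a i) := rfl

open Polynomial in
theorem egrs_weight {F : Type*} [Field F] [DecidableEq F] {n k : ℕ} (hk : 1 ≤ k) (hkn : k ≤ n)
    (a w : Fin n → F) (ha : Function.Injective a) (hw : ∀ i, w i ≠ 0) (f : degreeLT F k)
    (hf : f ≠ 0) : n - k + 2 ≤ hammingNorm (egrs k a w f) := by
  have hf0 : (f : F[X]) ≠ 0 := by simpa using hf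
  have hdeg : (f : F[X]).natDegree < k := by
    have := mem_degreeLT.1 f.2
    exact (natDegree_lt_iff_degree_lt hf0).2 this
  have hZ : (Finset.univ.filter (fun i : Fin n => (f : F[X]).eval (a i) = 0)).card
      ≤ (f : F[X]).natDegree := by
    rw [← Finset.card_image_of_injective _ ha]
    apply Polynomial.card_le_degree_of_subset_roots
    intro x hx
    simp only [Finset.image_val, Multiset.mem_dedup, Multiset.mem_map] at hx
    obtain ⟨i, hi, rfl⟩ := hx
    rw [mem_roots hf0]
    simpa using hi
  have hsplit := Finset.card_filter_add_card_filter_not (s := (Finset.univ : Finset (Fin (n+1))))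
    (fun i => egrs k a w f i = 0)
  have hnorm : hammingNorm (egrs k a w f) =
    (Finset.univ.filter (fun i => ¬ egrs k a w f i = 0)).card := rfl
  have hzero : (Finset.univ.filter (fun i => egrs k a w f i = 0)).card ≤ k - 1 := by
    rw [Fin.card_filter_univ_succ]
    simp only [egrs_succ, egrs_zero, mul_eq_zero, hw, false_or]
    split_ifs with h
    · have : (f : F[X]).natDegree ≠ k - 1 := by
        intro h'
        rw [← h'] at h
        exact hf0 (leadingCoeff_eq_zero.1 h)
      omega
    · omega
  simp only [Finset.card_univ, Fintype.card_fin] at hsplit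
  omega

open Polynomial in
theorem egrs_interp {F : Type*} [Field F] [DecidableEq F] {n k s : ℕ} (hsk : s + 1 ≤ k)
    (a : Fin n → F) (ha : Function.Injective a) (S : Finset (Fin n)) (hS : S.card = s)
    (c : F) (y : Fin n → F) :
    ∃ f : degreeLT F k, (f : F[X]).coeff (k - 1) = c ∧ ∀ i ∈ S, (f : F[X]).eval (a i) = y i := by
  set g := Lagrange.interpolate S a (fun i => y i - c * a i ^ (k - 1)) with hg
  have hgd : g.degree < s := hS ▸ Lagrange.degree_interpolate_lt _ ha.injOn
  refine ⟨⟨monomial (k - 1) c + g, ?_⟩, ?_, ?_⟩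
  · rw [mem_degreeLT]
    refine lt_of_le_of_lt (degree_add_le _ _) (max_lt ?_ ?_)
    · refine lt_of_le_of_lt (degree_monomial_le _ _) ?_
      exact_mod_cast (by omega : k - 1 < k)
    · exact hgd.trans_le (by exact_mod_cast (by omega))
  · simp only [coeff_add, coeff_monomial, if_true]
    rw [coeff_eq_zero_of_degree_lt (hgd.trans_le (by exact_mod_cast (by omega))), add_zero]
  · intro i hi
    simp only [eval_add, eval_monomial]
    rw [hg, Lagrange.eval_interpolate_at_node _ ha.injOn hi]
    ring

open Polynomial in
theorem code_part {F : Type*} [Field F] [DecidableEq F] {n k l Q : ℕ} (hQ : 0 < Q)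
    (hk : 1 ≤ k) (hl : l ≤ k - 1) (hkn : (k - 1) * (Q + 1) + 2 ≤ n)
    (a v : Fin n → F) (ha : Function.Injective a) (hv : ∀ i, v i ≠ 0)
    (hsum : ∀ f : F[X], f.natDegree + 2 ≤ n → ∑ i, v i ^ (Q + 1) * f.eval (a i) = 0)
    (α : F) (hα : α ≠ 0) (hα1 : α ^ (Q + 1) ≠ 1) :
    ∃ C : Submodule F (Fin (n + 1) → F),
      Module.finrank F C = k ∧
      (∀ c ∈ C, c ≠ 0 → n - k + 2 ≤ hammingNorm c) ∧
      Module.finrank F ↥(C ⊓ galoisDual Q C) = l := by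
  have hkn' : k ≤ n := by
    have : (k - 1) * 1 ≤ (k - 1) * (Q + 1) := Nat.mul_le_mul_left _ (by omega)
    omega
  obtain ⟨S, -, hS⟩ := Finset.exists_subset_card_eq
    (s := (Finset.univ : Finset (Fin n))) (n := k - 1 - l) (by simp; omega)
  set w : Fin n → F := fun i => if i ∈ S then α * v i else v i with hw_def
  have hw : ∀ i, w i ≠ 0 := by
    intro i
    simp only [hw_def]
    split_ifs
    · exact mul_ne_zero hα (hv i)
    · exact hv i
  set E := egrs k a w with hE
  have hwt := egrs_weight hk hkn' a w ha hw
  have hinj : Function.Injective E := by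
    rw [← LinearMap.ker_eq_bot, LinearMap.ker_eq_bot']
    intro f hf
    by_contra h
    have := hwt f h
    rw [← hE, hf, hammingNorm_zero] at this
    omega
  have hfin : Module.finrank F (degreeLT F k) = k := by
    rw [(degreeLTEquiv F k).finrank_eq]; simp
  have : FiniteDimensional F (degreeLT F k) := (degreeLTEquiv F k).symm.finiteDimensional
  refine ⟨LinearMap.range E, ?_, ?_, ?_⟩
  · rw [LinearMap.finrank_range_of_inj hinj, hfin]
  · rintro c ⟨f, rfl⟩ hc
    apply hwt
    rintro rfl
    simp at hc
  -- inner product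
  have hinner : ∀ f g : degreeLT F k, ∑ i, E f i * (E g i) ^ Q =
      (f : F[X]).coeff (k - 1) * (g : F[X]).coeff (k - 1) ^ Q +
      ∑ i ∈ S, ((α ^ (Q + 1) - 1) * v i ^ (Q + 1) * (f : F[X]).eval (a i)) *
        (g : F[X]).eval (a i) ^ Q := by
    intro f g
    rw [Fin.sum_univ_succ]
    simp only [hE, egrs_zero, egrs_succ]
    congr 1
    have hnat : ∀ f : degreeLT F k, (f : F[X]).natDegree ≤ k - 1 := by
      intro f
      have := mem_degreeLT.1 f.2
      by_cases h0 : (f : F[X]) = 0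
      · simp [h0]
      · have := (natDegree_lt_iff_degree_lt h0).2 this
        omega
    have h0 := hsum ((f : F[X]) * (g : F[X]) ^ Q) (by
      have h1 := natDegree_mul_le (p := (f : F[X])) (q := (g : F[X]) ^ Q)
      have h2 := natDegree_pow_le (p := (g : F[X])) (n := Q)
      have h3 := hnat f
      have h4 := Nat.mul_le_mul_left Q (hnat g)
      nlinarith)
    rw [← Finset.sum_filter_add_sum_filter_not _ (fun i => i ∈ S)] at h0 ⊢
    simp only [Finset.filter_univ_mem] at h0 ⊢
    rw [← sub_zero (_ + _), ← h0]
    have e2 : ∑ i with i ∉ S, w i * eval (a i) (f : F[X]) * (w i * eval (a i) (g : F[X])) ^ Q =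
        ∑ i with i ∉ S, v i ^ (Q + 1) * eval (a i) ((f : F[X]) * (g : F[X]) ^ Q) := by
      refine Finset.sum_congr rfl fun i hi => ?_
      have : i ∉ S := by simpa using hi
      simp only [hw_def, if_neg this, eval_mul, eval_pow]
      ring
    rw [e2, add_sub_add_right_eq_sub, ← Finset.sum_sub_distrib]
    refine Finset.sum_congr rfl fun i hi => ?_
    simp only [hw_def, if_pos hi, eval_mul, eval_pow]
    ring
  -- evaluation map whose kernel is the hull
  let D : degreeLT F k →ₗ[F] (F × (S → F)) :=
    { toFun := fun f => ((f : F[X]).coeff (k - 1), fun i => (f : F[X]).eval (a i))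
      map_add' := fun f g => by ext <;> simp
      map_smul' := fun f g => by ext <;> simp }
  have hDsurj : Function.Surjective D := by
    rintro ⟨c, y⟩
    obtain ⟨f, h1, h2⟩ := egrs_interp (k := k) (s := k - 1 - l) (by omega) a ha S hS c
      (fun i => if h : i ∈ S then y ⟨i, h⟩ else 0)
    refine ⟨f, Prod.ext h1 (funext fun i => ?_)⟩
    have := h2 i i.2
    simp only [i.2, dif_pos] at this
    exact this
  have hker : Module.finrank F (LinearMap.ker D) = l := by
    have h := D.finrank_range_add_finrank_ker
    rw [LinearMap.range_eq_top.2 hDsurj, hfin, finrank_top] at h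
    simp only [Module.finrank_prod, Module.finrank_self, Module.finrank_fintype_fun_eq_card,
      Fintype.card_coe, hS] at h
    omega
  have hhull : LinearMap.range E ⊓ galoisDual Q (LinearMap.range E) =
      (LinearMap.ker D).map E := by
    ext x
    simp only [Submodule.mem_inf, Submodule.mem_map, LinearMap.mem_range]
    constructor
    · rintro ⟨⟨f, rfl⟩, hx⟩
      refine ⟨f, ?_, rfl⟩
      have hx' : ∀ g, ∑ i, E f i * (E g i) ^ Q = 0 := fun g => hx _ ⟨g, rfl⟩
      simp only [hinner] at hx'
      rw [LinearMap.mem_ker]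
      refine Prod.ext ?_ (funext fun i => ?_)
      · obtain ⟨g, h1, h2⟩ := egrs_interp (k := k) (s := k - 1 - l) (by omega) a ha S hS 1
          (fun i => 0)
        have := hx' g
        rw [Finset.sum_eq_zero (fun i hi => by rw [h2 i hi, zero_pow hQ.ne', mul_zero]), h1] at this
        simp only [one_pow, mul_one, add_zero] at this
        exact this
      · obtain ⟨g, h1, h2⟩ := egrs_interp (k := k) (s := k - 1 - l) (by omega) a ha S hS 0
          (fun j => if j = i then 1 else 0)
        have := hx' g
        rw [Finset.sum_eq_single (i : Fin n) (fun j hj hji => by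
          rw [h2 j hj, if_neg hji, zero_pow hQ.ne', mul_zero]) (fun h => absurd i.2 h),
          h1, h2 i i.2] at this
        simp only [zero_pow hQ.ne', if_true, one_pow, mul_one, mul_zero, zero_add, mul_eq_zero,
          sub_eq_zero, hα1, pow_eq_zero_iff (Nat.succ_ne_zero Q), hv, false_or] at this
        exact this
    · rintro ⟨f, hf, rfl⟩
      refine ⟨⟨f, rfl⟩, ?_⟩
      rintro _ ⟨g, rfl⟩
      rw [hinner]
      rw [LinearMap.mem_ker] at hf
      have hf1 : (f : F[X]).coeff (k - 1) = 0 := congrArg Prod.fst hf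
      have hf2 : ∀ i ∈ S, (f : F[X]).eval (a i) = 0 := fun i hi =>
        congrFun (congrArg Prod.snd hf) ⟨i, hi⟩
      rw [hf1, Finset.sum_eq_zero (fun i hi => by rw [hf2 i hi]; simp)]
      simp
  rw [hhull, ← (Submodule.equivMapOfInjective E hinj _).finrank_eq, hker]

theorem exists_norm_root {F K : Type*} [Field F] [Field K] [Algebra K F] [Finite F]
    {Q m : ℕ} (hQ : 1 < Q) (hK : Nat.card K = Q) (hF : Nat.card F = Q ^ m) (hm : Even m)
    (c : K) (hc : c ≠ 0) : ∃ v : F, v ≠ 0 ∧ v ^ (Q + 1) = algebraMap K F c := by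
  have hfinK : Finite K := Finite.of_injective _ (algebraMap K F).injective
  obtain ⟨g, hg⟩ := IsCyclic.exists_generator (α := Fˣ)
  have hc' : algebraMap K F c ≠ 0 := by simpa using hc
  obtain ⟨j, hj⟩ := Subgroup.mem_zpowers_iff.1 (hg (Units.mk0 _ hc'))
  have hord : orderOf g = Q ^ m - 1 := by
    rw [orderOf_eq_card_of_forall_mem_zpowers hg, Nat.card_units, hF]
  have hpow : (g ^ j) ^ (Q - 1) = 1 := by
    rw [hj]
    ext
    have := Fintype.ofFinite K
    have := FiniteField.pow_card_sub_one_eq_one c hc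
    rw [Fintype.card_eq_nat_card, hK] at this
    simp [← map_pow, this]
  rw [← zpow_natCast, ← zpow_mul, ← orderOf_dvd_iff_zpow_eq_one, hord] at hpow
  obtain ⟨s, rfl⟩ := hm
  have hd : (Q + 1) * (Q - 1) ∣ Q ^ (s + s) - 1 := by
    have h1 : (Q + 1) * (Q - 1) = Q ^ 2 - 1 := by
      simpa using (Nat.sq_sub_sq Q 1).symm
    rw [h1, ← two_mul, pow_mul]
    simpa using Nat.sub_dvd_pow_sub_pow (Q ^ 2) 1 s
  have hd2 : ((Q + 1 : ℕ) : ℤ) * ((Q - 1 : ℕ) : ℤ) ∣ j * ((Q - 1 : ℕ) : ℤ) :=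
    dvd_trans (by exact_mod_cast hd) hpow
  have hne : ((Q - 1 : ℕ) : ℤ) ≠ 0 := by exact_mod_cast (by omega)
  obtain ⟨i, rfl⟩ := Int.dvd_of_mul_dvd_mul_right hne hd2
  refine ⟨((g ^ i : Fˣ) : F), Units.ne_zero _, ?_⟩
  have := congrArg Units.val hj
  rw [mul_comm, zpow_mul, zpow_natCast] at this
  simpa using this

theorem exists_alpha {F : Type*} [Field F] [Finite F]
    {Q m : ℕ} (hQ : 3 ≤ Q) (hF : Nat.card F = Q ^ m) (hm : 2 ≤ m) :
    ∃ α : F, α ≠ 0 ∧ α ^ (Q + 1) ≠ 1 := by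
  obtain ⟨g, hg⟩ := IsCyclic.exists_generator (α := Fˣ)
  have hord : orderOf g = Q ^ m - 1 := by
    rw [orderOf_eq_card_of_forall_mem_zpowers hg, Nat.card_units, hF]
  refine ⟨g, Units.ne_zero _, fun h => ?_⟩
  have h' : g ^ (Q + 1) = 1 := by ext; simpa using h
  have hle := Nat.le_of_dvd (by omega) (orderOf_dvd_of_pow_eq_one h')
  rw [hord] at hle
  have := Nat.pow_le_pow_right (by omega : 0 < Q) hm
  have : Q ^ 2 ≥ 3 * Q := by nlinarith
  omega

theorem prod_points {F K : Type*} [Field F] [DecidableEq F] [Field K] [Algebra K F]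
    (V : Submodule K F) [Fintype V] {t : ℕ} (β : Fin t → K)
    (hβ : Function.Injective β) (η : F) (i : Fin t) (v : V) :
    ∏ x ∈ Finset.univ.erase (i, v), ((algebraMap K F (β i) * η + v) -
        (algebraMap K F (β x.1) * η + x.2)) =
      (∏ u : V, if u = 0 then 1 else (u : F)) * (∏ u : V, (η + u)) ^ (t - 1) *
        algebraMap K F (∏ j ∈ Finset.univ.erase i, (β i - β j) ^ Fintype.card V) := by
  classical
  have h1 : ∏ x ∈ Finset.univ.erase (i, v), ((algebraMap K F (β i) * η + v) -
        (algebraMap K F (β x.1) * η + x.2)) =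
      ∏ x : Fin t × V, if x = (i, v) then 1 else ((algebraMap K F (β i) * η + v) -
        (algebraMap K F (β x.1) * η + x.2)) := by
    rw [← Finset.mul_prod_erase Finset.univ _ (Finset.mem_univ (i, v)), if_pos rfl, one_mul]
    exact Finset.prod_congr rfl fun x hx => (if_neg (Finset.ne_of_mem_erase hx)).symm
  rw [h1, Fintype.prod_prod_type, ← Finset.mul_prod_erase Finset.univ _ (Finset.mem_univ i),
    mul_assoc]
  congr 1
  · rw [← (Equiv.subLeft v).prod_comp]
    refine Finset.prod_congr rfl fun u _ => ?_
    simp only [Equiv.subLeft_apply, Prod.mk.injEq, true_and, sub_eq_self]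
    split_ifs
    · rfl
    · push_cast
      ring
  · rw [map_prod]
    have hc : t - 1 = (Finset.univ.erase i).card := by simp
    rw [hc, ← Finset.prod_const, ← Finset.prod_mul_distrib]
    refine Finset.prod_congr rfl fun j hj => ?_
    have hji := Finset.ne_of_mem_erase hj
    simp only [Prod.mk.injEq, hji, false_and, if_false]
    have hb : β i - β j ≠ 0 := sub_ne_zero.2 fun h => hji (hβ h).symm
    rw [← (Equiv.subLeft v).prod_comp, map_pow, ← Finset.card_univ, ← Finset.prod_const,
      ← Finset.prod_mul_distrib, 
      ← (LinearEquiv.smulOfNeZero K V _ hb).toEquiv.prod_comp]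
    refine Finset.prod_congr rfl fun u _ => ?_
    simp only [Equiv.subLeft_apply, LinearEquiv.coe_toEquiv, LinearEquiv.smulOfNeZero_apply]
    push_cast
    rw [Algebra.smul_def, map_sub]
    ring

open Polynomial in
theorem exists_points {F K : Type*} [Field F] [DecidableEq F] [Field K] [Algebra K F] [Finite F]
    {Q m r t n : ℕ} (hQ : 1 < Q) (hK : Nat.card K = Q) (hF : Nat.card F = Q ^ m) (hm : Even m)
    (hr : r < m) (ht : t ≤ Q) (hn : n = t * Q ^ r) :
    ∃ a v : Fin n → F, Function.Injective a ∧ (∀ i, v i ≠ 0) ∧ 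
      ∀ f : F[X], f.natDegree + 2 ≤ n → ∑ i, v i ^ (Q + 1) * f.eval (a i) = 0 := by
  have hfinK : Finite K := Finite.of_injective _ (algebraMap K F).injective
  have := Fintype.ofFinite K
  have hfr : Module.finrank K F = m := by
    have := Module.natCard_eq_pow_finrank (K := K) (V := F)
    rw [hK, hF] at this
    exact (Nat.pow_right_injective hQ this).symm
  obtain ⟨b, hb⟩ := exists_linearIndependent_of_le_finrank (R := K) (M := F) (hfr ▸ hr.le)
  set V : Submodule K F := Submodule.span K (Set.range b)
  have hV : Module.finrank K V = r := by
    rw [finrank_span_eq_card hb]; simp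
  have : Fintype V := Fintype.ofFinite V
  have hVcard : Fintype.card V = Q ^ r := by
    rw [Fintype.card_eq_nat_card, Module.natCard_eq_pow_finrank (K := K), hV, hK]
  obtain ⟨η, hη⟩ : ∃ η : F, η ∉ V := by
    by_contra! h
    have : V = ⊤ := by ext; simp [h]
    rw [this, finrank_top] at hV
    omega
  obtain ⟨β⟩ : Nonempty (Fin t ↪ K) := by
    apply Function.Embedding.nonempty_of_card_le
    rw [Fintype.card_fin, Fintype.card_eq_nat_card, hK]; exact ht
  let A : Fin t × V → F := fun x => algebraMap K F (β x.1) * η + x.2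
  have hA : Function.Injective A := by
    rintro ⟨i, u⟩ ⟨j, w⟩ h
    have h' : algebraMap K F (β i - β j) * η = (w : F) - u := by
      rw [map_sub]
      simp only [A] at h
      linear_combination h
    have hij : i = j := by
      by_contra hij
      apply hη
      have hne : β i - β j ≠ 0 := sub_ne_zero.2 fun h => hij (β.injective h)
      rw [← Algebra.smul_def] at h'
      have : η = (β i - β j)⁻¹ • ((w : F) - u) := by rw [← h', inv_smul_smul₀ hne]
      rw [this]
      exact V.smul_mem _ (V.sub_mem w.2 u.2)
    subst hij
    simp only [sub_self, map_zero, zero_mul] at h'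
    have : u = w := Subtype.ext (sub_eq_zero.1 h'.symm).symm
    rw [this]
  set c0 : F := (∏ u : V, if u = 0 then 1 else (u : F)) * (∏ u : V, (η + u)) ^ (t - 1) with hc0
  have hc0ne : c0 ≠ 0 := by
    refine mul_ne_zero (Finset.prod_ne_zero_iff.2 fun u _ => ?_)
      (pow_ne_zero _ (Finset.prod_ne_zero_iff.2 fun u _ h => hη ?_))
    · split_ifs with h
      · exact one_ne_zero
      · simpa using h
    · rw [eq_neg_of_add_eq_zero_left h]
      exact V.neg_mem u.2
  let d : Fin t → K := fun i => ∏ j ∈ Finset.univ.erase i, (β i - β j) ^ Fintype.card V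
  have hd : ∀ i, d i ≠ 0 := fun i => Finset.prod_ne_zero_iff.2 fun j hj => pow_ne_zero _
    (sub_ne_zero.2 fun h => (Finset.ne_of_mem_erase hj) (β.injective h).symm)
  choose w hw0 hw using fun i => exists_norm_root (F := F) hQ hK hF hm (d i)⁻¹ (inv_ne_zero (hd i))
  have hcard : Fintype.card (Fin t × V) = n := by
    rw [Fintype.card_prod, Fintype.card_fin, hVcard, hn]
  let eqv : Fin n ≃ Fin t × V := (Fintype.equivFinOfCardEq hcard).symm
  refine ⟨A ∘ eqv, fun i => w (eqv i).1, hA.comp eqv.injective, fun i => hw0 _, fun f hf => ?_⟩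
  have hs : ∑ i, w (eqv i).1 ^ (Q + 1) * f.eval ((A ∘ eqv) i) =
      ∑ x : Fin t × V, w x.1 ^ (Q + 1) * f.eval (A x) :=
    eqv.sum_comp (fun x => w x.1 ^ (Q + 1) * f.eval (A x))
  rw [hs]
  have hcoef := Lagrange.coeff_eq_sum (s := (Finset.univ : Finset (Fin t × V))) (v := A)
    hA.injOn (P := f) (by
      rw [Finset.card_univ, hcard]
      exact lt_of_le_of_lt degree_le_natDegree (by exact_mod_cast (by omega)))
  rw [Finset.card_univ, hcard, coeff_eq_zero_of_natDegree_lt (by omega)] at hcoef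
  have : ∀ x : Fin t × V, w x.1 ^ (Q + 1) * f.eval (A x) =
      c0 * (f.eval (A x) / ∏ j ∈ Finset.univ.erase x, (A x - A j)) := by
    rintro ⟨i, u⟩
    have hp := prod_points V β β.injective η i u
    rw [hw, map_inv₀]
    have hp' : ∏ j ∈ Finset.univ.erase (i, u), (A (i, u) - A j) = c0 * algebraMap K F (d i) := hp
    rw [hp']
    have : algebraMap K F (d i) ≠ 0 := by simpa using hd i
    field_simp
  rw [Finset.sum_congr rfl fun x _ => this x, ← Finset.mul_sum, ← hcoef, mul_zero]

theorem exists_MDS_with_galois_hull_dim_coset (p e m r t n k l : ℕ)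
    (hp : p.Prime) (hpodd : Odd p) (he : 0 < e) (hmeven : Even m)
    (ht : t ∣ p ^ e - 1) (hr : r ≤ m - 1) (hn : n = t * p ^ (e * r))
    (F : Type*) [Field F] [Fintype F] [DecidableEq F] [CharP F p]
    (hcard : Fintype.card F = p ^ (e * m))
    (hk1 : 1 ≤ k) (hk2 : k ≤ (p ^ e + n - 1) / (p ^ e + 1)) (hl : l ≤ k - 1) :
    ∃ C : Submodule F (Fin (n + 1) → F),
      Module.finrank F C = k ∧
      (∀ c ∈ C, c ≠ 0 → n - k + 2 ≤ hammingNorm c) ∧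
      Module.finrank F ↥(C ⊓ galoisDual (p ^ e) C) = l := by
  have hpf : Fact p.Prime := ⟨hp⟩
  have hm0 : m ≠ 0 := by
    rintro rfl
    have := Fintype.one_lt_card (α := F)
    simp [hcard] at this
  have hm2 : 2 ≤ m := by
    obtain ⟨s, rfl⟩ := hmeven
    omega
  have hp3 : 3 ≤ p := by
    have := hp.two_le
    obtain ⟨s, rfl⟩ := hpodd
    omega
  have hQ3 : 3 ≤ p ^ e := hp3.trans (Nat.le_self_pow he.ne' p)
  have htQ : t ≤ p ^ e := (Nat.le_of_dvd (by omega) ht).trans (Nat.sub_le _ _)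
  have hcF : Nat.card F = (p ^ e) ^ m := by
    rw [← Fintype.card_eq_nat_card, hcard, pow_mul]
  let _ : Algebra (ZMod p) F := ZMod.algebra F p
  have hfr : Module.finrank (ZMod p) F = e * m := by
    have := FiniteField.pow_finrank_eq_card p F
    rw [hcard] at this
    exact Nat.pow_right_injective hp.two_le this
  obtain ⟨φ⟩ := FiniteField.nonempty_algHom_of_finrank_dvd (F := ZMod p) (K := GaloisField p e)
    (L := F) (by rw [hfr, GaloisField.finrank p he.ne']; exact dvd_mul_right _ _)
  let _ : Algebra (GaloisField p e) F := φ.toRingHom.toAlgebra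
  obtain ⟨a, v, ha, hv, hsum⟩ := exists_points (F := F) (K := GaloisField p e) (Q := p ^ e)
    (m := m) (r := r) (t := t) (n := n) (by omega) (GaloisField.card p e he.ne') hcF hmeven
    (by omega) htQ (by rw [hn, pow_mul])
  obtain ⟨α, hα, hα1⟩ := exists_alpha hQ3 hcF hm2
  refine code_part (by omega) hk1 hl ?_ a v ha hv hsum α hα hα1
  have h := (Nat.le_div_iff_mul_le (by omega)).1 hk2
  obtain ⟨k, rfl⟩ : ∃ k', k = k' + 1 := ⟨k - 1, by omega⟩
  rw [add_mul] at h
  simp only [Nat.add_sub_cancel]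
  omega
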